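/- A topological space X is extremally disconnected (the closure of every open subset of X is open) if and only if the map from the empty space to X has the left lifting property with respect to the map q : D₄ → D₃, where D₄ is the four-point space on {u, z', z, v} whose open sets are the up-sets of the preorder generated by z' ≤ u and z ≤ v (a ≤ b meaning a ∈ cl{b}), D₃ is the three-point space on {u, z, v} whose open sets are the up-sets of the preorder generated by z ≤ u and z ≤ v, and q glues z' to z and fixes u and v. -/

import Mathlib

/-- The Alexandrov topology on a preordered set: open sets are exactly the
upward-closed sets (here `p ≤ q` means `p ∈ closure {q}`). -/
def upTop (α : Type*) [Preorder α] : TopologicalSpace α where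
  IsOpen s := ∀ ⦃a b : α⦄, a ∈ s → a ≤ b → b ∈ s
  isOpen_univ := fun _ _ _ _ => trivial
  isOpen_inter := fun s t hs ht a b hab hle => ⟨hs hab.1 hle, ht hab.2 hle⟩
  isOpen_sUnion := fun S hS a b ha hle => by
    obtain ⟨s, hsS, has⟩ := ha
    exact ⟨s, hsS, hS s hsS has hle⟩

/-- The preorder generated by a relation `r`: its `≤` is the reflexive-transitive
closure of `r`. -/
def genPreorder {α : Type*} (r : α → α → Prop) : Preorder α where
  le := Relation.ReflTransGen r
  le_refl _ := Relation.ReflTransGen.refl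
  le_trans _ _ _ h h' := Relation.ReflTransGen.trans h h'

/-- A continuous map `f : A → B` has the left lifting property with respect to a
continuous map `g : Z → Y` if for all continuous `u : A → Z` and `v : B → Y`
with `g ∘ u = v ∘ f` there is a continuous `d : B → Z` with `d ∘ f = u` and
`g ∘ d = v`. -/
def HasLLP {A B Z Y : Type*} [TopologicalSpace A] [TopologicalSpace B]
    [TopologicalSpace Z] [TopologicalSpace Y] (f : A → B) (g : Z → Y) : Prop :=
  ∀ (u : A → Z) (v : B → Y), Continuous u → Continuous v → g ∘ u = v ∘ f →
    ∃ d : B → Z, Continuous d ∧ d ∘ f = u ∧ g ∘ d = v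

/-- The four-point space on `{u, z', z, v}`. -/
inductive D4e | u | z' | z | v

/-- Generating relation for the preorder on `D4e`: `z' ≤ u` and `z ≤ v`
(`a ≤ b` meaning `a ∈ closure {b}`). -/
def rD4e : D4e → D4e → Prop := fun a b =>
  (a = D4e.z' ∧ b = D4e.u) ∨ (a = D4e.z ∧ b = D4e.v)

instance : Preorder D4e := genPreorder rD4e
instance : TopologicalSpace D4e := upTop D4e

/-- The three-point space on `{u, z, v}`. -/
inductive D3e | u | z | v

/-- Generating relation for the preorder on `D3e`: `z ≤ u` and `z ≤ v`. -/
def rD3e : D3e → D3e → Prop := fun a b =>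
  (a = D3e.z ∧ b = D3e.u) ∨ (a = D3e.z ∧ b = D3e.v)

instance : Preorder D3e := genPreorder rD3e
instance : TopologicalSpace D3e := upTop D3e

/-- The map `q : D₄ → D₃` gluing `z'` to `z` and fixing `u` and `v`. -/
def qD4e : D4e → D3e
  | D4e.u => D3e.u
  | D4e.z' => D3e.z
  | D4e.z => D3e.z
  | D4e.v => D3e.v

/-- In the Alexandrov topology of a generated preorder, the open sets are the sets closed
under the generating relation. -/
theorem isOpen_upTop_genPreorder {α : Type*} {r : α → α → Prop} {s : Set α} :
    @IsOpen α (@upTop α (genPreorder r)) s ↔ ∀ a b, a ∈ s → r a b → b ∈ s := by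
  refine ⟨fun h a b ha hab => h ha (Relation.ReflTransGen.single hab), fun h a b ha hab => ?_⟩
  change Relation.ReflTransGen r a b at hab
  induction hab with
  | refl => exact ha
  | tail _ hbc ih => exact h _ _ ih hbc

theorem D3e.isOpen_iff {s : Set D3e} :
    IsOpen s ↔ (D3e.z ∈ s → D3e.u ∈ s) ∧ (D3e.z ∈ s → D3e.v ∈ s) := by
  refine isOpen_upTop_genPreorder.trans ⟨fun h => ⟨fun hz => h _ _ hz (.inl ⟨rfl, rfl⟩),
    fun hz => h _ _ hz (.inr ⟨rfl, rfl⟩)⟩, ?_⟩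
  rintro ⟨hu, hv⟩ a b ha (⟨rfl, rfl⟩ | ⟨rfl, rfl⟩)
  exacts [hu ha, hv ha]

theorem D4e.isOpen_iff {s : Set D4e} :
    IsOpen s ↔ (D4e.z' ∈ s → D4e.u ∈ s) ∧ (D4e.z ∈ s → D4e.v ∈ s) := by
  refine isOpen_upTop_genPreorder.trans ⟨fun h => ⟨fun hz => h _ _ hz (.inl ⟨rfl, rfl⟩),
    fun hz => h _ _ hz (.inr ⟨rfl, rfl⟩)⟩, ?_⟩
  rintro ⟨hu, hv⟩ a b ha (⟨rfl, rfl⟩ | ⟨rfl, rfl⟩)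
  exacts [hu ha, hv ha]

theorem D3e.continuous_iff {X : Type*} [TopologicalSpace X] {f : X → D3e} :
    Continuous f ↔ IsOpen (f ⁻¹' {D3e.u}) ∧ IsOpen (f ⁻¹' {D3e.v}) := by
  refine ⟨fun h => ⟨(D3e.isOpen_iff.2 (by simp)).preimage h,
    (D3e.isOpen_iff.2 (by simp)).preimage h⟩, fun ⟨hu, hv⟩ => continuous_def.2 fun s hs => ?_⟩
  obtain ⟨hzu, hzv⟩ := D3e.isOpen_iff.1 hs
  refine isOpen_iff_mem_nhds.2 fun x hx => ?_
  rw [Set.mem_preimage] at hx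
  cases hfx : f x <;> rw [hfx] at hx
  · exact Filter.mem_of_superset (hu.mem_nhds hfx) fun y (hy : f y = _) => by
      rwa [Set.mem_preimage, hy]
  · refine Filter.univ_mem' fun y => ?_
    change f y ∈ s
    cases f y
    exacts [hzu hx, hx, hzv hx]
  · exact Filter.mem_of_superset (hv.mem_nhds hfx) fun y (hy : f y = _) => by
      rwa [Set.mem_preimage, hy]

theorem D4e.continuous_of_isOpen_preimage {X : Type*} [TopologicalSpace X] {f : X → D4e}
    (hu : IsOpen (f ⁻¹' {D4e.u})) (hz' : IsOpen (f ⁻¹' {D4e.u, D4e.z'}))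
    (hv : IsOpen (f ⁻¹' {D4e.v})) (hz : IsOpen (f ⁻¹' {D4e.v, D4e.z})) : Continuous f := by
  refine continuous_def.2 fun s hs => ?_
  obtain ⟨hzu, hzv⟩ := D4e.isOpen_iff.1 hs
  refine isOpen_iff_mem_nhds.2 fun x hx => ?_
  rw [Set.mem_preimage] at hx
  cases hfx : f x <;> rw [hfx] at hx
  · refine Filter.mem_of_superset (hu.mem_nhds hfx) fun y (hy : f y = _) => ?_
    rwa [Set.mem_preimage, hy]
  · refine Filter.mem_of_superset (hz'.mem_nhds (.inr hfx)) ?_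
    rintro y (hy | hy) <;> rw [Set.mem_preimage, hy]
    exacts [hzu hx, hx]
  · refine Filter.mem_of_superset (hz.mem_nhds (.inr hfx)) ?_
    rintro y (hy | hy) <;> rw [Set.mem_preimage, hy]
    exacts [hzv hx, hx]
  · refine Filter.mem_of_superset (hv.mem_nhds hfx) fun y (hy : f y = _) => ?_
    rwa [Set.mem_preimage, hy]

/-- The lift to `D4e` of a map `f` to `D3e`, which sends a point over `z` to `z'` exactly
when it lies in `C`. -/
noncomputable def D4e.liftAlong {X : Type*} (f : X → D3e) (C : Set X) (x : X) : D4e :=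
  open Classical in
  match f x with
  | D3e.u => D4e.u
  | D3e.z => if x ∈ C then D4e.z' else D4e.z
  | D3e.v => D4e.v

/-- The map to `D3e` with fibre `U` over `u` and the exterior of `U` over `v`. -/
noncomputable def D3e.ofSet {X : Type*} [TopologicalSpace X] (U : Set X) (x : X) : D3e :=
  open Classical in
  if x ∈ U then D3e.u else if x ∈ closure U then D3e.z else D3e.v

theorem D4e.exists_lift {X : Type*} [TopologicalSpace X]
    (hX : ∀ U : Set X, IsOpen U → IsOpen (closure U)) {f : X → D3e} (hf : Continuous f) :
    ∃ d : X → D4e, Continuous d ∧ qD4e ∘ d = f := by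
  obtain ⟨hu, hv⟩ := D3e.continuous_iff.1 hf
  set C := closure (f ⁻¹' {D3e.u}) with hC
  have hCu : ∀ x, f x = D3e.u → x ∈ C := fun x hx => subset_closure hx
  have hCv : ∀ x, f x = D3e.v → x ∉ C := fun x hx hxC => by
    obtain ⟨y, hyv, hyu⟩ := mem_closure_iff.1 hxC _ hv hx
    cases (show f y = _ from hyv).symm.trans hyu
  refine ⟨D4e.liftAlong f C, D4e.continuous_of_isOpen_preimage ?_ ?_ ?_ ?_, ?_⟩
  · convert hu using 1
    ext x
    cases hx : f x <;> simp [D4e.liftAlong, hx]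
    split_ifs <;> simp
  · convert hX _ hu using 1
    ext x
    rw [← hC]
    cases hx : f x <;> simp [D4e.liftAlong, hx, hCu, hCv]
    split_ifs <;> simp_all
  · convert hv using 1
    ext x
    cases hx : f x <;> simp [D4e.liftAlong, hx]
    split_ifs <;> simp
  · convert (isClosed_closure (s := f ⁻¹' {D3e.u})).isOpen_compl using 1
    ext x
    rw [← hC]
    cases hx : f x <;> simp [D4e.liftAlong, hx, hCu, hCv]
    split_ifs <;> simp_all
  · funext x
    cases hx : f x <;> simp only [Function.comp_apply, D4e.liftAlong, hx, qD4e]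
    split_ifs <;> rfl

theorem D3e.continuous_ofSet {X : Type*} [TopologicalSpace X] {U : Set X} (hU : IsOpen U) :
    Continuous (D3e.ofSet U) := by
  refine D3e.continuous_iff.2 ⟨?_, ?_⟩
  · convert hU using 1
    ext x
    simp only [Set.mem_preimage, Set.mem_singleton_iff, D3e.ofSet]
    split_ifs <;> simp_all
  · convert (isClosed_closure (s := U)).isOpen_compl using 1
    ext x
    have := @subset_closure X _ U x
    simp only [Set.mem_preimage, Set.mem_singleton_iff, D3e.ofSet]
    split_ifs <;> simp_all

theorem isOpen_closure_of_lift {X : Type*} [TopologicalSpace X] {U : Set X} {d : X → D4e}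
    (hd : Continuous d) (hdU : qD4e ∘ d = D3e.ofSet U) : IsOpen (closure U) := by
  have hopen : IsOpen (d ⁻¹' {D4e.u, D4e.z'}) := (D4e.isOpen_iff.2 (by simp)).preimage hd
  have hclosed : IsClosed (d ⁻¹' {D4e.u, D4e.z'}) :=
    IsClosed.preimage hd ⟨D4e.isOpen_iff.2 (by simp)⟩
  convert hopen using 1
  refine (closure_minimal (fun x hx => ?_) hclosed).antisymm fun x hx => ?_
  · have := congrFun hdU x
    simp only [Function.comp_apply, D3e.ofSet, if_pos hx] at this
    rw [Set.mem_preimage]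
    cases h : d x <;> simp_all [qD4e]
  · by_contra hxU
    have := congrFun hdU x
    simp only [Function.comp_apply, D3e.ofSet, if_neg hxU,
      if_neg fun h => hxU (subset_closure h)] at this
    rcases hx with hx | hx <;> rw [hx] at this <;> cases this

/-- A topological space `X` is extremally disconnected (the closure of every
open subset of `X` is open) iff the map from the empty space to `X` has the
left lifting property with respect to the gluing map `q : D₄ → D₃`. -/
theorem statement18 {X : Type*} [TopologicalSpace X] :
    (∀ U : Set X, IsOpen U → IsOpen (closure U)) ↔
      HasLLP (Empty.elim : Empty → X) qD4e := by
  refine ⟨fun hX _ f _ hf _ => ?_, fun h U hU => ?_⟩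
  · obtain ⟨d, hd, hdf⟩ := D4e.exists_lift hX hf
    exact ⟨d, hd, funext fun x => x.elim, hdf⟩
  · obtain ⟨d, hd, -, hdU⟩ := h Empty.elim (D3e.ofSet U) (by fun_prop)
      (D3e.continuous_ofSet hU) (funext fun x => x.elim)
    exact isOpen_closure_of_lift hd hdU
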